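/- Let L, L_r, L_s, Σ, Q be a normed continuous-time Markov game structure, fix t ∈ ℝ and ε > 0, and let ‖·‖ denote the sup-norm on functions L → ℝ. Let f : L → ℝ → ℝ solve the Bellman equations on [t−ε, t] with terminal value f(·, t), and let p : L → ℝ → ℝ be any function with ‖f(·,t) − p(·,t)‖ ≤ μ. Let f̃ : L → ℝ → ℝ solve the Bellman equations on [t−ε, t] with terminal value p(·,t). If ‖f̃(·, t−ε) − p(·, t−ε)‖ ≤ ν, then ‖f(·, t−ε) − p(·, t−ε)‖ ≤ μ + ν. -/

import Mathlib

/-- A normed continuous-time Markov game structure: a finite nonempty set `L` of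
locations partitioned into reachability locations (`isReach l = true`) and safety
locations (`isReach l = false`), a finite set `A` of actions with a nonempty set
`enabled l` of enabled actions at each location, and a rate matrix `R` whose rows
(for enabled actions) are probability distributions on `L`. -/
structure NCTMG (L A : Type) [Fintype L] [DecidableEq L] [Fintype A] where
  isReach : L → Bool
  enabled : L → Finset A
  enabled_nonempty : ∀ l, (enabled l).Nonempty
  R : L → A → L → ℝ
  R_nonneg : ∀ l a l', a ∈ enabled l → 0 ≤ R l a l'
  R_sum : ∀ l a, a ∈ enabled l → (∑ l', R l a l') = 1

namespace NCTMG

variable {L A : Type} [Fintype L] [DecidableEq L] [Fintype A]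

/-- The generator `Q(l,a,l') = R(l,a,l') − δ_{l,l'}`. -/
def Q (M : NCTMG L A) (l : L) (a : A) (l' : L) : ℝ :=
  M.R l a l' - (if l = l' then 1 else 0)

/-- `opt_l`: maximum over enabled actions at reachability locations, minimum
over enabled actions at safety locations. -/
noncomputable def opt (M : NCTMG L A) (l : L) (v : A → ℝ) : ℝ :=
  if M.isReach l then (M.enabled l).sup' (M.enabled_nonempty l) v
  else (M.enabled l).inf' (M.enabled_nonempty l) v

/-- `f` solves the Bellman equations on `[t−ε, t]` with terminal value `x`. -/
def SolvesBellman (M : NCTMG L A) (t ε : ℝ) (x : L → ℝ) (f : L → ℝ → ℝ) : Prop :=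
  (∀ l, f l t = x l) ∧
  ∀ l, ∀ τ ∈ Set.Icc (t - ε) t,
    HasDerivAt (f l) (-(M.opt l (fun a => ∑ l', M.Q l a l' * f l' τ))) τ

/-- `p1` is a single `ε`-net approximation from terminal value `x` with chosen
actions `act`: each `act l` is enabled and attains `opt_l` of `∑ Q(l,a,·)·x`,
and `p1(l, t−τ) = x(l) + τ·c_l` on `[0,ε]` where `c_l = ∑ Q(l,act l,·)·x`. -/
def IsSingleNet (M : NCTMG L A) (t ε : ℝ) (x : L → ℝ) (act : L → A)
    (p1 : L → ℝ → ℝ) : Prop :=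
  (∀ l, act l ∈ M.enabled l) ∧
  (∀ l, (∑ l', M.Q l (act l) l' * x l') =
      M.opt l (fun a => ∑ l', M.Q l a l' * x l')) ∧
  (∀ l, ∀ τ ∈ Set.Icc (0 : ℝ) ε,
      p1 l (t - τ) = x l + τ * (∑ l', M.Q l (act l) l' * x l'))

end NCTMG

/-- The sup-norm `‖v‖ = max_{l∈L} |v l|` on functions `L → ℝ`. -/
noncomputable def supNorm {L : Type} [Fintype L] [Nonempty L] (v : L → ℝ) : ℝ :=
  Finset.univ.sup' Finset.univ_nonempty (fun l => |v l|)

namespace NCTMG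

variable {L A : Type} [Fintype L] [DecidableEq L] [Fintype A]

lemma opt_le_opt_add (M : NCTMG L A) (l : L) {u w : A → ℝ} {c : ℝ}
    (h : ∀ a ∈ M.enabled l, u a ≤ w a + c) : M.opt l u ≤ M.opt l w + c := by
  unfold opt
  split_ifs
  · refine Finset.sup'_le _ _ fun a ha => (h a ha).trans ?_
    gcongr
    exact Finset.le_sup' w ha
  · rw [← sub_le_iff_le_add]
    refine Finset.le_inf' _ _ fun a ha => ?_
    rw [sub_le_iff_le_add]
    exact (Finset.inf'_le u ha).trans (h a ha)

lemma sum_Q_mul (M : NCTMG L A) (l : L) (a : A) (v : L → ℝ) :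
    ∑ l', M.Q l a l' * v l' = ∑ l', M.R l a l' * v l' - v l := by
  simp [Q, sub_mul, Finset.sum_sub_distrib]

lemma opt_sum_Q_le (M : NCTMG L A) (l : L) (v w : L → ℝ) :
    M.opt l (fun a => ∑ l', M.Q l a l' * v l') ≤
      M.opt l (fun a => ∑ l', M.Q l a l' * w l') + (‖v - w‖ - (v l - w l)) := by
  refine M.opt_le_opt_add l fun a ha => ?_
  have key : ∑ l', M.R l a l' * v l' ≤ ∑ l', M.R l a l' * (w l' + ‖v - w‖) := by
    refine Finset.sum_le_sum fun l' _ => mul_le_mul_of_nonneg_left ?_ (M.R_nonneg l a l' ha)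
    have := (le_abs_self _).trans (norm_le_pi_norm (v - w) l')
    simp only [Pi.sub_apply] at this
    linarith
  simp only [mul_add, Finset.sum_add_distrib, ← Finset.sum_mul, M.R_sum l a ha, one_mul] at key
  rw [sum_Q_mul, sum_Q_mul]
  linarith

/-- The uniformized Bellman operator `v ↦ opt_l (∑ Q v) + v l` is nonexpansive in the sup-norm. -/
lemma abs_opt_sum_Q_sub_add_le (M : NCTMG L A) (l : L) (v w : L → ℝ) :
    |M.opt l (fun a => ∑ l', M.Q l a l' * v l') - M.opt l (fun a => ∑ l', M.Q l a l' * w l')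
      + (v l - w l)| ≤ ‖v - w‖ := by
  have h₁ := M.opt_sum_Q_le l v w
  have h₂ := M.opt_sum_Q_le l w v
  rw [norm_sub_rev w v] at h₂
  rw [abs_le]
  constructor <;> linarith

/-- The Bellman flow, run backwards from `t` to `t - ε`, is nonexpansive in the sup-norm. -/
lemma SolvesBellman.norm_sub_le {M : NCTMG L A} {t ε : ℝ} {x y : L → ℝ} {f g : L → ℝ → ℝ}
    (hf : M.SolvesBellman t ε x f) (hg : M.SolvesBellman t ε y g) (hε : 0 ≤ ε) :
    ‖(fun l => f l (t - ε)) - fun l => g l (t - ε)‖ ≤ ‖x - y‖ := by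
  let d : ℝ → L → ℝ := fun s => (fun l => f l (t - s)) - fun l => g l (t - s)
  let d' : ℝ → L → ℝ := fun s l =>
    M.opt l (fun a => ∑ l', M.Q l a l' * f l' (t - s)) -
      M.opt l (fun a => ∑ l', M.Q l a l' * g l' (t - s))
  have hd : ∀ s ∈ Set.Icc 0 ε, HasDerivAt d (d' s) s := by
    rintro s ⟨hs₀, hs₁⟩
    have hs : t - s ∈ Set.Icc (t - ε) t := ⟨by linarith, by linarith⟩
    rw [hasDerivAt_pi]
    intro l
    have hsub : HasDerivAt (fun s => t - s) (-1) s := by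
      simpa using (hasDerivAt_id s).const_sub t
    have h := ((hf.2 l _ hs).comp s hsub).sub ((hg.2 l _ hs).comp s hsub)
    simp only [mul_neg, mul_one, neg_neg] at h
    exact h
  have hexp : ∀ s ∈ Set.Icc 0 ε, HasDerivAt (fun s => Real.exp s • d s)
      (Real.exp s • d' s + Real.exp s • d s) s := fun s hs =>
    (Real.hasDerivAt_exp s).smul (hd s hs)
  have hbound : ∀ s, ‖Real.exp s • d' s + Real.exp s • d s‖ ≤ 1 * ‖Real.exp s • d s‖ + 0 := by
    intro s
    rw [← smul_add, norm_smul, norm_smul, one_mul, add_zero]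
    gcongr
    exact (pi_norm_le_iff_of_nonneg (norm_nonneg _)).2 fun l =>
      M.abs_opt_sum_Q_sub_add_le l _ _
  have h := norm_le_gronwallBound_of_norm_deriv_right_le
    (fun s hs => (hexp s hs).continuousAt.continuousWithinAt)
    (fun s hs => (hexp s (Set.Ico_subset_Icc_self hs)).hasDerivWithinAt)
    le_rfl (fun s _ => hbound s) ε ⟨hε, le_rfl⟩
  have hd₀ : d 0 = x - y := by
    ext l
    simp [d, hf.1 l, hg.1 l]
  rw [gronwallBound_ε0, norm_smul, Real.norm_of_nonneg (Real.exp_pos ε).le, Real.exp_zero,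
    one_smul, hd₀, sub_zero, one_mul, mul_comm] at h
  exact le_of_mul_le_mul_right h (Real.exp_pos ε)

end NCTMG

lemma supNorm_eq_norm {L : Type} [Fintype L] [Nonempty L] (v : L → ℝ) : supNorm v = ‖v‖ := by
  refine le_antisymm (Finset.sup'_le _ _ fun l _ => norm_le_pi_norm v l) ?_
  exact (pi_norm_le_iff_of_nonempty v).2 fun l =>
    Finset.le_sup' (fun l => |v l|) (Finset.mem_univ l)

/-- if the terminal error of an approximation `p` is at most `μ`
and the Bellman solution started from `p(·,t)` deviates from `p` at time `t−ε`
by at most `ν`, then `p` deviates from the true Bellman solution at time `t−ε`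
by at most `μ + ν`. -/
theorem bellman_step_error_global {L A : Type} [Fintype L] [DecidableEq L]
    [Nonempty L] [Fintype A] (M : NCTMG L A) (t ε μ ν : ℝ) (hε : 0 < ε)
    (f p ftilde : L → ℝ → ℝ)
    (hf : M.SolvesBellman t ε (fun l => f l t) f)
    (hμ : supNorm (fun l => f l t - p l t) ≤ μ)
    (hftilde : M.SolvesBellman t ε (fun l => p l t) ftilde)
    (hν : supNorm (fun l => ftilde l (t - ε) - p l (t - ε)) ≤ ν) :
    supNorm (fun l => f l (t - ε) - p l (t - ε)) ≤ μ + ν := by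
  rw [supNorm_eq_norm] at *
  have hflow := hf.norm_sub_le hftilde hε.le
  exact (norm_sub_le_norm_sub_add_norm_sub (fun l => f l (t - ε)) (fun l => ftilde l (t - ε))
    (fun l => p l (t - ε))).trans (add_le_add (hflow.trans hμ) hν)
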